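/- arXiv:2007.02284 — 3 statements merged into one kernel-verified Lean document; each statement's English description precedes it below -/
import Mathlib

section
/- (Key step of Theorem 2.1, taken from the earlier paper's Theorem 2.1.) Assume ∫_{t₀}^∞ s·Q(s) ds = ∞, Q is integrable on [t,∞) for each t > t₀, and there exists T₀ ≥ t₀ such that for every T ≥ T₀ one has, for all sufficiently large t ≥ T, (1/m(t))·∫_T^t (s−T)Q(s)m(s) ds + (t−T)·∫_t^∞ Q(s) ds > 1. Then there is no twice continuously differentiable function v on (t₀,∞) and no T ≥ t₀ such that v(t) > 0, v'(t) > 0 and v''(t) < −Q(t)v(m(t)) for all t ≥ T. -/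
/-- A continuous lower bound for the derivative integrates to a lower bound for the increment. -/
theorem integral_le_sub_of_hasDerivAt {F F' f : ℝ → ℝ} {a b : ℝ} (hab : a ≤ b)
    (hF : ∀ x ∈ Set.Icc a b, HasDerivAt F (F' x) x) (hf : ContinuousOn f (Set.Icc a b))
    (hle : ∀ x ∈ Set.Icc a b, f x ≤ F' x) : ∫ x in a..b, f x ≤ F b - F a :=
  intervalIntegral.integral_le_sub_of_hasDeriv_right_of_le hab
    (fun x hx => (hF x hx).continuousAt.continuousWithinAt)
    (fun x hx => (hF x (Set.Ioo_subset_Icc_self hx)).hasDerivWithinAt)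
    hf.integrableOn_Icc (fun x hx => hle x (Set.Ioo_subset_Icc_self hx))

/-- Divergence of the integral to `+∞` does not depend on the lower endpoint. -/
theorem tendsto_intervalIntegral_atTop_of_lt {f : ℝ → ℝ} {t₀ a : ℝ} (ha : t₀ < a)
    (hf : Filter.Tendsto (fun t => ∫ s in t₀..t, f s) Filter.atTop Filter.atTop) :
    Filter.Tendsto (fun t => ∫ s in a..t, f s) Filter.atTop Filter.atTop := by
  refine (Filter.tendsto_atTop_add_const_right _ (-∫ s in t₀..a, f s) hf).congr' ?_
  filter_upwards [hf.eventually_gt_atTop 0, Filter.eventually_ge_atTop a] with t ht hat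
  have hright : IntervalIntegrable f MeasureTheory.volume t₀ t := by
    by_contra h
    rw [intervalIntegral.integral_undef h] at ht
    exact lt_irrefl _ ht
  have hleft : IntervalIntegrable f MeasureTheory.volume t₀ a :=
    hright.mono_set (by
      rw [Set.uIcc_of_le ha.le, Set.uIcc_of_le (ha.le.trans hat)]
      exact Set.Icc_subset_Icc_right hat)
  rw [← sub_eq_add_neg]
  exact intervalIntegral.integral_interval_sub_left hright hleft

/-- If `v` is differentiable with `t v' ≤ v` on a positive ray, then `v t / t` is antitone there. -/
theorem antitoneOn_div_id_of_mul_deriv_le {v v' : ℝ → ℝ} {a : ℝ} (ha : 0 < a)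
    (hv : ∀ t, a ≤ t → HasDerivAt v (v' t) t) (hle : ∀ t, a ≤ t → t * v' t ≤ v t) :
    AntitoneOn (fun t => v t / t) (Set.Ici a) := by
  have hd : ∀ t, a ≤ t → HasDerivAt (fun t => v t / t) ((v' t * t - v t * 1) / t ^ 2) t :=
    fun t ht => (hv t ht).div (hasDerivAt_id t) (ha.trans_le ht).ne'
  refine antitoneOn_of_deriv_nonpos (convex_Ici a)
    (fun t ht => (hd t ht).continuousAt.continuousWithinAt)
    (fun t ht => (hd t (interior_subset ht)).differentiableAt.differentiableWithinAt) ?_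
  intro t ht
  have hat : a ≤ t := interior_subset ht
  rw [(hd t hat).deriv]
  exact div_nonpos_of_nonpos_of_nonneg (by linarith [hle t hat, mul_comm t (v' t)]) (sq_nonneg t)

/-- The derivative of `v - (t - c) v'` is `-(t - c) v''`. -/
theorem hasDerivAt_sub_mul_deriv {v v' v'' : ℝ → ℝ} {t : ℝ} (c : ℝ)
    (hv : HasDerivAt v (v' t) t) (hv' : HasDerivAt v' (v'' t) t) :
    HasDerivAt (fun t => v t - (t - c) * v' t) ((t - c) * -v'' t) t := by
  refine (hv.sub (((hasDerivAt_id t).sub_const c).mul hv')).congr_deriv ?_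
  simp only [id]
  ring

/-- key step of Theorem 2.1: if `∫_{t₀}^∞ s Q(s) ds = ∞`, `Q` is
integrable at infinity and the criterion
`(1/m(t)) ∫_T^t (s−T)Q(s)m(s) ds + (t−T) ∫_t^∞ Q(s) ds > 1` holds for all
sufficiently large `t` (for every `T ≥ T₀`), then there is no `C²` function `v`
on `(t₀,∞)` with `v > 0`, `v' > 0` and `v'' < −Q·(v ∘ m)` on some ray `[T,∞)`. -/
theorem no_positive_increasing_solution
    (t₀ : ℝ) (ht₀ : 0 < t₀)
    (Q m : ℝ → ℝ)
    (hQc : ContinuousOn Q (Set.Ioi t₀)) (hQpos : ∀ t, t₀ < t → 0 < Q t)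
    (hmc : ContinuousOn m (Set.Ioi t₀)) (hmmono : StrictMonoOn m (Set.Ioi t₀))
    (hmt : ∀ t, t₀ < t → t ≤ m t)
    (hsQ : Filter.Tendsto (fun t => ∫ s in t₀..t, s * Q s)
      Filter.atTop Filter.atTop)
    (hQint : ∀ t, t₀ < t → MeasureTheory.IntegrableOn Q (Set.Ici t))
    (hcrit : ∃ T₀, t₀ ≤ T₀ ∧ ∀ T, T₀ ≤ T →
      ∀ᶠ t in Filter.atTop,
        (1 / m t) * (∫ s in T..t, (s - T) * Q s * m s)
          + (t - T) * (∫ s in Set.Ioi t, Q s) > 1) :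
    ¬ ∃ (v v' v'' : ℝ → ℝ) (T : ℝ),
      t₀ ≤ T ∧
      (∀ t, t₀ < t → HasDerivAt v (v' t) t) ∧
      (∀ t, t₀ < t → HasDerivAt v' (v'' t) t) ∧
      ContinuousOn v'' (Set.Ioi t₀) ∧
      (∀ t, T ≤ t → 0 < v t ∧ 0 < v' t ∧ v'' t < -(Q t * v (m t))) := by
  rintro ⟨v, v', v'', T, hT, hv, hv', -, hpos⟩
  obtain ⟨T₀, -, hcrit⟩ := hcrit
  obtain ⟨a, haT, hat₀⟩ : ∃ a, T ≤ a ∧ t₀ < a := ⟨T + 1, by linarith, by linarith⟩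
  have hsub : ∀ {b c : ℝ}, a ≤ b → Set.Icc b c ⊆ Set.Ioi t₀ :=
    fun hb x hx => hat₀.trans_le (hb.trans hx.1)
  have hmono : MonotoneOn v (Set.Ici a) := by
    refine monotoneOn_of_deriv_nonneg (convex_Ici a)
      (fun t ht => (hv t (hat₀.trans_le ht)).continuousAt.continuousWithinAt)
      (fun t ht => (hv t (hat₀.trans_le (interior_subset ht))).differentiableAt
        |>.differentiableWithinAt) ?_
    intro t ht
    have hat : a ≤ t := interior_subset ht
    rw [(hv t (hat₀.trans_le hat)).deriv]
    exact (hpos t (haT.trans hat)).2.1.le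
  have hma : ∀ t, a ≤ t → a ≤ m t := fun t ht => ht.trans (hmt t (hat₀.trans_le ht))
  have hva : 0 < v a := (hpos a haT).1
  have hev : ∀ᶠ t in Filter.atTop, t * v' t ≤ v t := by
    have hdiv := tendsto_intervalIntegral_atTop_of_lt hat₀ hsQ
    filter_upwards [(hdiv.const_mul_atTop hva).eventually_ge_atTop (-(v a - (a - 0) * v' a)),
      Filter.eventually_ge_atTop a] with t hlarge hat
    have hinc := integral_le_sub_of_hasDerivAt (f := fun s => v a * (s * Q s)) hat
      (fun x hx => hasDerivAt_sub_mul_deriv (v'' := v'') 0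
        (hv x (hsub le_rfl hx)) (hv' x (hsub le_rfl hx)))
      (continuousOn_const.mul (continuousOn_id.mul (hQc.mono (hsub le_rfl))))
      (fun x hx => by
        have hx₀ : t₀ < x := hsub le_rfl hx
        have hx0 : 0 ≤ x := (ht₀.trans hx₀).le
        have h1 := (hpos x (haT.trans hx.1)).2.2
        have h2 : Q x * v a ≤ Q x * v (m x) :=
          mul_le_mul_of_nonneg_left (hmono Set.self_mem_Ici (hma x hx.1) (hma x hx.1)) (hQpos x hx₀).le
        calc v a * (x * Q x) = (x - 0) * (Q x * v a) := by ring
          _ ≤ (x - 0) * -v'' x := mul_le_mul_of_nonneg_left (by linarith) (by linarith))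
    rw [intervalIntegral.integral_const_mul] at hinc
    simp only [sub_zero] at hinc hlarge
    linarith
  obtain ⟨b, hb⟩ := Filter.eventually_atTop.1 hev
  obtain ⟨S, hST₀, hSa, hSb⟩ : ∃ S, T₀ ≤ S ∧ a ≤ S ∧ b ≤ S :=
    ⟨max T₀ (max a b), by simp, by simp, by simp⟩
  have hSt₀ : t₀ < S := hat₀.trans_le hSa
  have hanti := antitoneOn_div_id_of_mul_deriv_le (ht₀.trans hSt₀)
    (fun t ht => hv t (hSt₀.trans_le ht)) (fun t ht => hb t (hSb.trans ht))
  obtain ⟨t, hcrit_t, hSt⟩ := ((hcrit S hST₀).and (Filter.eventually_ge_atTop S)).exists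
  have hat : a ≤ t := hSa.trans hSt
  have htt₀ : t₀ < t := hat₀.trans_le hat
  have hmS : ∀ s, S ≤ s → S ≤ m s := fun s hs => hs.trans (hmt s (hSt₀.trans_le hs))
  have hleft : v (m t) / m t * (∫ s in S..t, (s - S) * Q s * m s)
      ≤ (v t - (t - S) * v' t) - (v S - (S - S) * v' S) := by
    rw [← intervalIntegral.integral_const_mul]
    refine integral_le_sub_of_hasDerivAt hSt
      (fun x hx => hasDerivAt_sub_mul_deriv (v'' := v'') S
        (hv x (hsub hSa hx)) (hv' x (hsub hSa hx)))
      (continuousOn_const.mul (((continuousOn_id.sub continuousOn_const).mul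
        (hQc.mono (hsub hSa))).mul (hmc.mono (hsub hSa)))) ?_
    intro x hx
    have hx₀ : t₀ < x := hsub hSa hx
    have hm0 : 0 < m x := ht₀.trans (hSt₀.trans_le (hmS x hx.1))
    have hratio : v (m t) / m t ≤ v (m x) / m x :=
      hanti (hmS x hx.1) (hmS t hSt) (hmmono.monotoneOn hx₀ htt₀ hx.2)
    rw [le_div_iff₀ hm0] at hratio
    have h1 := (hpos x (haT.trans (hSa.trans hx.1))).2.2
    have h2 := mul_le_mul_of_nonneg_left hratio (hQpos x hx₀).le
    calc v (m t) / m t * ((x - S) * Q x * m x)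
        = (x - S) * (Q x * (v (m t) / m t * m x)) := by ring
      _ ≤ (x - S) * -v'' x := mul_le_mul_of_nonneg_left (by linarith) (by linarith [hx.1])
  have hright : v (m t) * (∫ s in Set.Ioi t, Q s) ≤ v' t := by
    have hlim := (MeasureTheory.intervalIntegral_tendsto_integral_Ioi t
      ((hQint t htt₀).mono_set Set.Ioi_subset_Ici_self) Filter.tendsto_id).const_mul (v (m t))
    refine le_of_tendsto hlim ?_
    filter_upwards [Filter.eventually_ge_atTop t] with r hr
    have hinc := integral_le_sub_of_hasDerivAt (f := fun s => v (m t) * Q s) hr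
      (fun x hx => (hv' x (hsub hat hx)).neg)
      (continuousOn_const.mul (hQc.mono (hsub hat)))
      (fun x hx => by
        have hx₀ : t₀ < x := hsub hat hx
        have h1 := (hpos x (haT.trans (hat.trans hx.1))).2.2
        have h2 := mul_le_mul_of_nonneg_left
          (hmono (hma t hat) (hma x (hat.trans hx.1)) (hmmono.monotoneOn htt₀ hx₀ hx.1))
          (hQpos x hx₀).le
        linarith [mul_comm (v (m t)) (Q x)])
    rw [intervalIntegral.integral_const_mul] at hinc
    have hr' := (hpos r (haT.trans (hat.trans hr))).2.1
    simp only [Pi.neg_apply, id] at hinc ⊢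
    linarith
  have hvm : 0 < v (m t) := (hpos _ (haT.trans (hma t hat))).1
  have hvS : 0 < v S := (hpos S (haT.trans hSa)).1
  have hvt : v t ≤ v (m t) := hmono hat (hma t hat) (hmt t htt₀)
  have hright' := mul_le_mul_of_nonneg_left hright (sub_nonneg.2 hSt)
  have hmul := mul_lt_mul_of_pos_left hcrit_t hvm
  have hexpand : v (m t) * ((1 / m t) * (∫ s in S..t, (s - S) * Q s * m s)
      + (t - S) * (∫ s in Set.Ioi t, Q s))
      = v (m t) / m t * (∫ s in S..t, (s - S) * Q s * m s)
        + (t - S) * (v (m t) * ∫ s in Set.Ioi t, Q s) := by ring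
  rw [hexpand, mul_one] at hmul
  rw [sub_self, zero_mul] at hleft
  linarith
end

section
/- (Case (1) of Theorem 2.4.) Let b : (t₀,∞) → ℝ be continuously differentiable with b(t) > 0 for all t > t₀, and let T₁ > t₀ be such that limsup_{t→∞} ∫_{T₁}^t [ b(s)Q_*(s) − (1/4)·r(s)b(s)·(b'(s)/b(s) − h(s)/r(s))² ] ds = ∞. Then there is no twice continuously differentiable function v on (t₀,∞) with v(t) > 0, v'(t) > 0 and (r(t)v'(t))' + h(t)v'(t) + Q_*(t)v(m(t)) < 0 for all t ≥ T₁. -/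
/-- Case (1) of Theorem 2.4: if `b > 0` is `C¹` and
`limsup_{t→∞} ∫_{T₁}^t [ b Q_* − (1/4) r b (b'/b − h/r)² ] ds = ∞` for some
`T₁ > t₀`, then there is no `C²` function `v` on `(t₀,∞)` with `v > 0`,
`v' > 0` and `(r v')' + h v' + Q_* (v ∘ m) < 0` on `[T₁,∞)`. -/
theorem no_positive_increasing_solution_case1
    (t₀ : ℝ) (ht₀ : 0 < t₀)
    (r r' h Qs m : ℝ → ℝ)
    (hrd : ∀ t, t₀ < t → HasDerivAt r (r' t) t)
    (hr'c : ContinuousOn r' (Set.Ioi t₀))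
    (hrpos : ∀ t, t₀ < t → 0 < r t)
    (hhc : ContinuousOn h (Set.Ioi t₀))
    (hQc : ContinuousOn Qs (Set.Ioi t₀)) (hQpos : ∀ t, t₀ < t → 0 < Qs t)
    (hmc : ContinuousOn m (Set.Ioi t₀)) (hmmono : StrictMonoOn m (Set.Ioi t₀))
    (hmt : ∀ t, t₀ < t → t ≤ m t)
    (b b' : ℝ → ℝ)
    (hbd : ∀ t, t₀ < t → HasDerivAt b (b' t) t)
    (hb'c : ContinuousOn b' (Set.Ioi t₀))
    (hbpos : ∀ t, t₀ < t → 0 < b t)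
    (T₁ : ℝ) (hT₁ : t₀ < T₁)
    (hlimsup : ∀ M : ℝ, ∃ᶠ t in Filter.atTop,
      M < ∫ s in T₁..t,
        (b s * Qs s - (1 / 4) * r s * b s * (b' s / b s - h s / r s) ^ 2)) :
    ¬ ∃ (v v' v'' : ℝ → ℝ),
      (∀ t, t₀ < t → HasDerivAt v (v' t) t) ∧
      (∀ t, t₀ < t → HasDerivAt v' (v'' t) t) ∧
      ContinuousOn v'' (Set.Ioi t₀) ∧
      (∀ t, T₁ ≤ t → 0 < v t ∧ 0 < v' t ∧
        (r' t * v' t + r t * v'' t) + h t * v' t + Qs t * v (m t) < 0) := by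
  rintro ⟨v, v', v'', hv, hv', -, hpos⟩
  have hsub : ∀ {t}, T₁ ≤ t → t₀ < t := fun ht => hT₁.trans_le ht
  have hmono : MonotoneOn v (Set.Ici T₁) := by
    refine monotoneOn_of_hasDerivWithinAt_nonneg (f' := v') (convex_Ici T₁)
      (fun t ht => (hv t (hsub ht)).continuousAt.continuousWithinAt) ?_ ?_
    · intro t ht
      rw [interior_Ici] at ht
      exact (hv t (hsub (le_of_lt ht))).hasDerivWithinAt
    · intro t ht
      rw [interior_Ici] at ht
      exact (hpos t (le_of_lt ht)).2.1.le
  have hw : ∀ t, T₁ ≤ t → HasDerivAt (fun s => -(b s * (r s * v' s) / v s))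
      (-(((b' t * (r t * v' t) + b t * (r' t * v' t + r t * v'' t)) * v t
        - b t * (r t * v' t) * v' t) / v t ^ 2)) t := fun t ht =>
    (((hbd t (hsub ht)).mul ((hrd t (hsub ht)).mul (hv' t (hsub ht)))).div
      (hv t (hsub ht)) (hpos t ht).1.ne').neg
  have hle : ∀ t, T₁ ≤ t →
      b t * Qs t - (1 / 4) * r t * b t * (b' t / b t - h t / r t) ^ 2 ≤
      -(((b' t * (r t * v' t) + b t * (r' t * v' t + r t * v'' t)) * v t
        - b t * (r t * v' t) * v' t) / v t ^ 2) := by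
    intro t ht
    obtain ⟨hv0, -, hineq⟩ := hpos t ht
    have hb := hbpos t (hsub ht)
    have hr := hrpos t (hsub ht)
    have hvm : v t ≤ v (m t) :=
      hmono ht (ht.trans (hmt t (hsub ht))) (hmt t (hsub ht))
    have hQv := mul_le_mul_of_nonneg_left hvm (hQpos t (hsub ht)).le
    have hE : 0 ≤ b t * (-(r' t * v' t + r t * v'' t) - h t * v' t - Qs t * v t) / v t :=
      div_nonneg (mul_nonneg hb.le (by linarith)) hv0.le
    have hsq : 0 ≤ r t * b t * (v' t / v t - (b' t / b t - h t / r t) / 2) ^ 2 := by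
      positivity
    have key : -(((b' t * (r t * v' t) + b t * (r' t * v' t + r t * v'' t)) * v t
        - b t * (r t * v' t) * v' t) / v t ^ 2)
        - (b t * Qs t - (1 / 4) * r t * b t * (b' t / b t - h t / r t) ^ 2)
        = b t * (-(r' t * v' t + r t * v'' t) - h t * v' t - Qs t * v t) / v t
        + r t * b t * (v' t / v t - (b' t / b t - h t / r t) / 2) ^ 2 := by
      field_simp
      ring
    linarith
  have hcont : ContinuousOn (fun s => b s * Qs s -
      (1 / 4) * r s * b s * (b' s / b s - h s / r s) ^ 2) (Set.Ioi t₀) := by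
    have hb : ContinuousOn b (Set.Ioi t₀) := fun t ht =>
      (hbd t ht).continuousAt.continuousWithinAt
    have hr : ContinuousOn r (Set.Ioi t₀) := fun t ht =>
      (hrd t ht).continuousAt.continuousWithinAt
    exact (hb.mul hQc).sub (((continuousOn_const.mul hr).mul hb).mul
      (((hb'c.div hb fun t ht => (hbpos t ht).ne').sub
        (hhc.div hr fun t ht => (hrpos t ht).ne')).pow 2))
  obtain ⟨t, hMt, ht⟩ := ((hlimsup (b T₁ * (r T₁ * v' T₁) / v T₁)).and_eventually
    (Filter.eventually_ge_atTop T₁)).exists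
  have hint := intervalIntegral.integral_le_sub_of_hasDeriv_right_of_le ht
    (fun s hs => (hw s hs.1).continuousAt.continuousWithinAt)
    (fun s hs => (hw s hs.1.le).hasDerivWithinAt)
    ((hcont.mono fun s hs => hsub hs.1).integrableOn_Icc)
    (fun s hs => hle s hs.1.le)
  have hwt : 0 < b t * (r t * v' t) / v t :=
    div_pos (mul_pos (hbpos t (hsub ht)) (mul_pos (hrpos t (hsub ht)) (hpos t ht).2.1))
      (hpos t ht).1
  linarith
end

section
/- (ODE form of Theorem 2.4, case (2).) Assume: (b) ∫_{t₀}^∞ (1/r(s))·exp(−∫_{t₀}^s h(τ)/r(τ) dτ) ds < ∞; (2.1) there exist a continuously differentiable function b : (t₀,∞) → ℝ with b(t) > 0 for all t > t₀ and some T₁ > t₀ such that limsup_{t→∞} ∫_{T₁}^t [ b(s)Q_*(s) − (1/4)·r(s)b(s)·(b'(s)/b(s) − h(s)/r(s))² ] ds = ∞; and (2.1001) for every T_* ≥ t₀, setting θ(t) := ∫_t^∞ (1/r(τ))·exp(−∫_{T_*}^τ h(s)/r(s) ds) dτ (finite by (b)), there exist T₂ ≥ T_* and T₃ ≥ T_*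 such that limsup_{t→∞} ∫_{T₃}^t (1/(r(τ)·exp(∫_{T_*}^τ h(s)/r(s) ds)))·( ∫_{T₂}^τ Q_*(s)·θ(m(s))·exp(∫_{T_*}^s h(η)/r(η) dη) ds ) dτ = ∞. Then the inequality (∗∗): (r(t)v'(t))' + h(t)v'(t) + Q_*(t)v(m(t)) < 0 has no eventually positive solution. -/
open MeasureTheory Set Filter

lemma intervalIntegrable_of_continuousOn_Ioi {f : ℝ → ℝ} {a x y : ℝ}
    (hf : ContinuousOn f (Ioi a)) (hx : a < x) (hy : a < y) :
    IntervalIntegrable f volume x y :=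
  (hf.mono fun _ hz => (lt_min hx hy).trans_le hz.1).intervalIntegrable

lemma continuousOn_primitive_Ioi {f : ℝ → ℝ} {a c : ℝ} (hc : a < c)
    (hf : ∀ x y, a < x → a < y → IntervalIntegrable f volume x y) :
    ContinuousOn (fun t => ∫ s in c..t, f s) (Ioi a) := by
  intro x hx
  obtain ⟨l, hal, hl⟩ := exists_between (lt_min hc hx)
  obtain ⟨hlc, hlx⟩ := lt_min_iff.1 hl
  obtain ⟨u, hu⟩ := exists_gt (max c x)
  obtain ⟨huc, hux⟩ := max_lt_iff.1 hu
  have h := intervalIntegral.continuousOn_primitive_interval' (a := c)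
    (hf l u hal (hal.trans (hlc.trans huc))) (by
      rw [uIcc_of_le (hlc.trans huc).le]; exact ⟨hlc.le, huc.le⟩)
  rw [uIcc_of_le (hlc.trans huc).le] at h
  exact (h.continuousAt (Icc_mem_nhds hlx hux)).continuousWithinAt

lemma hasDerivAt_primitive_of_continuousOn_Ioi {f : ℝ → ℝ} {a c x : ℝ} (hc : a < c)
    (hf : ContinuousOn f (Ioi a)) (hx : a < x) :
    HasDerivAt (fun t => ∫ s in c..t, f s) (f x) x :=
  intervalIntegral.integral_hasDerivAt_right
    (intervalIntegrable_of_continuousOn_Ioi hf hc hx)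
    (hf.stronglyMeasurableAtFilter isOpen_Ioi x hx)
    (hf.continuousAt (Ioi_mem_nhds hx))

lemma not_forall_frequently_lt_integral {f : ℝ → ℝ} {T S C : ℝ}
    (hf : ∀ t, S ≤ t → IntervalIntegrable f volume T t)
    (hC : ∀ t, S ≤ t → ∫ s in S..t, f s ≤ C) :
    ¬ ∀ M : ℝ, ∃ᶠ t in atTop, M < ∫ s in T..t, f s := by
  intro h
  refine h ((∫ s in T..S, f s) + C) ?_
  filter_upwards [eventually_ge_atTop S] with t ht
  have hTS := hf S le_rfl
  rw [← intervalIntegral.integral_add_adjacent_intervals hTS (hTS.symm.trans (hf t ht))]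
  linarith [hC t ht]

lemma integrableOn_Ioi_of_continuousOn_of_integrableOn {f : ℝ → ℝ} {a x y : ℝ}
    (hf : ContinuousOn f (Ioi a)) (hx : a < x) (hfy : IntegrableOn f (Ioi y)) :
    IntegrableOn f (Ioi x) := by
  have hxy : IntegrableOn f (Icc x y) :=
    (hf.mono fun z hz => hx.trans_le hz.1).integrableOn_Icc
  refine (hxy.union hfy).mono_set fun z hz => ?_
  rcases le_or_gt z y with h | h
  exacts [Or.inl ⟨le_of_lt hz, h⟩, Or.inr h]

lemma antitoneOn_integral_Ioi {f : ℝ → ℝ} {a : ℝ} (hf : ContinuousOn f (Ioi a))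
    (hpos : ∀ x, a < x → 0 ≤ f x) :
    AntitoneOn (fun t => ∫ s in Ioi t, f s) (Ioi a) := by
  intro x hx y hy hxy
  by_cases hint : IntegrableOn f (Ioi x)
  · refine setIntegral_mono_set hint ?_ (Ioi_subset_Ioi hxy).eventuallyLE
    filter_upwards [ae_restrict_mem measurableSet_Ioi] with z hz
    exact hpos z (lt_trans hx hz)
  · have hint' : ¬ IntegrableOn f (Ioi y) := fun h =>
      hint (integrableOn_Ioi_of_continuousOn_of_integrableOn hf hx h)
    simp only
    rw [integral_undef hint, integral_undef hint']

/-- A nonnegative function decaying at rate at least `k * f` dominates `k` times the tail integral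
of `f`; the bound is trivial when that tail is not integrable. -/
lemma mul_integral_Ioi_le_of_deriv_le {f v v' : ℝ → ℝ} {k t : ℝ}
    (hf : ContinuousOn f (Ici t))
    (hv : ∀ x, t ≤ x → HasDerivAt v (v' x) x) (hv0 : ∀ x, t ≤ x → 0 ≤ v x)
    (hle : ∀ x, t ≤ x → v' x ≤ -(k * f x)) :
    k * ∫ s in Ioi t, f s ≤ v t := by
  by_cases hint : IntegrableOn f (Ioi t)
  · have hlim := (intervalIntegral_tendsto_integral_Ioi t hint tendsto_id).const_mul k
    refine le_of_tendsto hlim ?_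
    filter_upwards [eventually_ge_atTop t] with x hx
    have := intervalIntegral.sub_le_integral_of_hasDeriv_right_of_le (g := v) (g' := v')
      (φ := fun s => -(k * f s)) hx
      (fun z hz => (hv z hz.1).continuousAt.continuousWithinAt)
      (fun z hz => (hv z hz.1.le).hasDerivWithinAt)
      ((hf.mono fun z hz => hz.1).const_mul k |>.neg.integrableOn_Icc)
      (fun z hz => hle z hz.1.le)
    rw [intervalIntegral.integral_neg, intervalIntegral.integral_const_mul] at this
    simp only [id]
    linarith [hv0 x hx]
  · rw [integral_undef hint, mul_zero]
    exact hv0 t le_rfl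

/-- Completing the square in the Riccati inequality. -/
lemma riccati_le {b b' r h q v v' N vm : ℝ} (hb : 0 < b) (hr : 0 < r) (hv : 0 < v) (hq : 0 < q)
    (hvm : v ≤ vm) (hN : N + h * v' + q * vm < 0) :
    b * q - (1 / 4) * r * b * (b' / b - h / r) ^ 2 ≤
      -(((b' * (r * v') + b * N) * v - b * (r * v') * v') / v ^ 2) := by
  have hN' : N + h * v' + q * v ≤ 0 := by nlinarith
  have hkey : -(((b' * (r * v') + b * N) * v - b * (r * v') * v') / v ^ 2)
      - (b * q - (1 / 4) * r * b * (b' / b - h / r) ^ 2)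
      = b * r * (v' / v - (b' / b - h / r) / 2) ^ 2 + b / v * -(N + h * v' + q * v) := by
    field_simp
    ring
  have h1 : 0 ≤ b * r * (v' / v - (b' / b - h / r) / 2) ^ 2 := by positivity
  have h2 : 0 ≤ b / v * -(N + h * v' + q * v) := mul_nonneg (by positivity) (by linarith)
  linarith

lemma riccati_integral_le {b b' r r' h q v v' v'' vm : ℝ → ℝ} {S t : ℝ} (hSt : S ≤ t)
    (hb : ∀ x, S ≤ x → HasDerivAt b (b' x) x) (hr : ∀ x, S ≤ x → HasDerivAt r (r' x) x)
    (hv : ∀ x, S ≤ x → HasDerivAt v (v' x) x) (hv' : ∀ x, S ≤ x → HasDerivAt v' (v'' x) x)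
    (hb0 : ∀ x, S ≤ x → 0 < b x) (hr0 : ∀ x, S ≤ x → 0 < r x) (hq0 : ∀ x, S ≤ x → 0 < q x)
    (hv0 : ∀ x, S ≤ x → 0 < v x) (hv'0 : ∀ x, S ≤ x → 0 ≤ v' x)
    (hvm : ∀ x, S ≤ x → v x ≤ vm x)
    (hineq : ∀ x, S ≤ x → (r' x * v' x + r x * v'' x) + h x * v' x + q x * vm x < 0)
    (hint : IntegrableOn
      (fun s => b s * q s - (1 / 4) * r s * b s * (b' s / b s - h s / r s) ^ 2) (Icc S t)) :
    ∫ s in S..t, (b s * q s - (1 / 4) * r s * b s * (b' s / b s - h s / r s) ^ 2) ≤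
      b S * (r S * v' S) / v S := by
  have hd : ∀ x, S ≤ x → HasDerivAt (fun s => -(b s * (r s * v' s) / v s))
      (-(((b' x * (r x * v' x) + b x * (r' x * v' x + r x * v'' x)) * v x
        - b x * (r x * v' x) * v' x) / v x ^ 2)) x := fun x hx =>
    (((hb x hx).mul ((hr x hx).mul (hv' x hx))).div (hv x hx) (hv0 x hx).ne').neg
  have := intervalIntegral.integral_le_sub_of_hasDeriv_right_of_le hSt
    (fun z hz => (hd z hz.1).continuousAt.continuousWithinAt)
    (fun z hz => (hd z hz.1.le).hasDerivWithinAt) hint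
    (fun z hz => riccati_le (hb0 z hz.1.le) (hr0 z hz.1.le) (hv0 z hz.1.le) (hq0 z hz.1.le)
      (hvm z hz.1.le) (hineq z hz.1.le))
  have hpos : 0 ≤ b t * (r t * v' t) / v t :=
    div_nonneg (mul_nonneg (hb0 t hSt).le (mul_nonneg (hr0 t hSt).le (hv'0 t hSt)))
      (hv0 t hSt).le
  linarith

/-- If `y = v' / f` is negative at `S` and decreases at rate at least `g * v ∘ m`, where `v` is
positive on `[S, ∞)`, then `f` times the integrated tail `∫ g θ ∘ m` has bounded integral. -/
lemma integral_tail_le {f g m v y y' : ℝ → ℝ} {S T t : ℝ} (hST : S ≤ T) (hTt : T ≤ t)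
    (hf : ContinuousOn f (Ici S)) (hf0 : ∀ x, S ≤ x → 0 < f x) (hg0 : ∀ x, S ≤ x → 0 ≤ g x)
    (hm : ∀ x, S ≤ x → x ≤ m x)
    (hv : ∀ x, S ≤ x → HasDerivAt v (f x * y x) x) (hv0 : ∀ x, S ≤ x → 0 ≤ v x)
    (hy : ∀ x, S ≤ x → HasDerivAt y (y' x) x) (hy' : ∀ x, S ≤ x → y' x ≤ -(g x * v (m x)))
    (hyS : y S < 0)
    {T₂ : ℝ} (hST₂ : S ≤ T₂) (hT₂ : T₂ ≤ T)
    (hI : IntegrableOn (fun s => g s * ∫ σ in Ioi (m s), f σ) (Icc T₂ t))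
    (hF : IntegrableOn (fun τ => f τ * ∫ s in T₂..τ, g s * ∫ σ in Ioi (m s), f σ) (Icc T t)) :
    ∫ τ in T..t, (f τ * ∫ s in T₂..τ, g s * ∫ σ in Ioi (m s), f σ) ≤ v T / -y S := by
  have hanti : AntitoneOn y (Ici S) :=
    antitoneOn_of_hasDerivWithinAt_nonpos (convex_Ici S)
      (fun x hx => (hy x hx).continuousAt.continuousWithinAt)
      (fun x hx => (hy x (interior_subset hx)).hasDerivWithinAt)
      (fun x hx => (hy' x (interior_subset hx)).trans (neg_nonpos.2
        (mul_nonneg (hg0 x (interior_subset hx))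
          (hv0 _ (le_trans (interior_subset hx) (hm x (interior_subset hx)))))))
  have htail : ∀ x, S ≤ x → -y S * ∫ σ in Ioi x, f σ ≤ v x := fun x hx =>
    mul_integral_Ioi_le_of_deriv_le (hf.mono (Ici_subset_Ici.2 hx))
      (fun z hz => hv z (hx.trans hz)) (fun z hz => hv0 z (hx.trans hz)) fun z hz => by
        have h1 := hanti self_mem_Ici (hx.trans hz : S ≤ z) (hx.trans hz)
        have h2 := mul_le_mul_of_nonneg_left h1 (hf0 z (hx.trans hz)).le
        linarith
  have hyle : ∀ τ, T₂ ≤ τ → τ ≤ t →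
      y τ ≤ y S * ∫ s in T₂..τ, g s * ∫ σ in Ioi (m s), f σ := by
    intro τ h1 h2
    have := intervalIntegral.sub_le_integral_of_hasDeriv_right_of_le (g := y) (g' := y')
      (φ := fun s => y S * (g s * ∫ σ in Ioi (m s), f σ)) h1
      (fun z hz => (hy z (hST₂.trans hz.1)).continuousAt.continuousWithinAt)
      (fun z hz => (hy z (hST₂.trans hz.1.le)).hasDerivWithinAt)
      ((hI.mono_set (Icc_subset_Icc_right h2)).const_mul (y S))
      (fun z hz => by
        have hz' := hST₂.trans hz.1.le
        have h3 := mul_le_mul_of_nonneg_left (htail (m z) (hz'.trans (hm z hz'))) (hg0 z hz')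
        linarith [hy' z hz'])
    rw [intervalIntegral.integral_const_mul] at this
    have h4 : y T₂ ≤ y S := hanti self_mem_Ici hST₂ hST₂
    linarith
  have hfin := intervalIntegral.sub_le_integral_of_hasDeriv_right_of_le (g := v)
    (g' := fun x => f x * y x)
    (φ := fun τ => y S * (f τ * ∫ s in T₂..τ, g s * ∫ σ in Ioi (m s), f σ)) hTt
    (fun z hz => (hv z (hST.trans hz.1)).continuousAt.continuousWithinAt)
    (fun z hz => (hv z (hST.trans hz.1.le)).hasDerivWithinAt)
    (hF.const_mul (y S))
    (fun z hz => by
      have h3 := mul_le_mul_of_nonneg_left (hyle z (hT₂.trans hz.1.le) hz.2.le)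
        (hf0 z (hST.trans hz.1.le)).le
      linarith)
  rw [intervalIntegral.integral_const_mul] at hfin
  rw [le_div_iff₀ (neg_pos.2 hyS)]
  linarith [hv0 t (hST.trans hTt)]


/-- ODE form of Theorem 2.4, case (2): assume
(b) `∫_{t₀}^∞ (1/r(s)) exp(−∫_{t₀}^s h/r) ds < ∞`,
(2.1) there are a positive `C¹` function `b` and `T₁ > t₀` with
`limsup_{t→∞} ∫_{T₁}^t [ b Q_* − (1/4) r b (b'/b − h/r)² ] ds = ∞`, and
(2.1001) for every `T_* ≥ t₀`, setting
`θ(t) := ∫_t^∞ (1/r(τ)) exp(−∫_{T_*}^τ h/r) dτ`, there exist `T₂, T₃ ≥ T_*`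
with `limsup_{t→∞} ∫_{T₃}^t (1/(r(τ) exp(∫_{T_*}^τ h/r)))
∫_{T₂}^τ Q_*(s) θ(m(s)) exp(∫_{T_*}^s h/r) ds dτ = ∞`.
Then `(∗∗): (r v')' + h v' + Q_* (v ∘ m) < 0` has no eventually positive
solution. -/
theorem no_eventually_positive_solution_thm24_case2
    (t₀ : ℝ) (ht₀ : 0 < t₀)
    (r r' h Qs m : ℝ → ℝ)
    (hrd : ∀ t, t₀ < t → HasDerivAt r (r' t) t)
    (hr'c : ContinuousOn r' (Set.Ioi t₀))
    (hrpos : ∀ t, t₀ < t → 0 < r t)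
    (hhc : ContinuousOn h (Set.Ioi t₀))
    (hQc : ContinuousOn Qs (Set.Ioi t₀)) (hQpos : ∀ t, t₀ < t → 0 < Qs t)
    (hmc : ContinuousOn m (Set.Ioi t₀)) (hmmono : StrictMonoOn m (Set.Ioi t₀))
    (hmt : ∀ t, t₀ < t → t ≤ m t)
    (hconv : MeasureTheory.IntegrableOn
      (fun s => (1 / r s) * Real.exp (-∫ τ in t₀..s, h τ / r τ))
      (Set.Ioi t₀))
    (b b' : ℝ → ℝ)
    (hbd : ∀ t, t₀ < t → HasDerivAt b (b' t) t)
    (hb'c : ContinuousOn b' (Set.Ioi t₀))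
    (hbpos : ∀ t, t₀ < t → 0 < b t)
    (T₁ : ℝ) (hT₁ : t₀ < T₁)
    (hlimsup : ∀ M : ℝ, ∃ᶠ t in Filter.atTop,
      M < ∫ s in T₁..t,
        (b s * Qs s - (1 / 4) * r s * b s * (b' s / b s - h s / r s) ^ 2))
    (hcrit : ∀ Ts, t₀ ≤ Ts → ∃ T₂, Ts ≤ T₂ ∧ ∃ T₃, Ts ≤ T₃ ∧
      ∀ M : ℝ, ∃ᶠ t in Filter.atTop,
        M < ∫ τ in T₃..t,
          (1 / (r τ * Real.exp (∫ s in Ts..τ, h s / r s)))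
            * ∫ s in T₂..τ, Qs s
                * (∫ σ in Set.Ioi (m s),
                    (1 / r σ) * Real.exp (-∫ η in Ts..σ, h η / r η))
                * Real.exp (∫ η in Ts..s, h η / r η)) :
    ¬ ∃ (v v' v'' : ℝ → ℝ) (t₁ : ℝ),
      t₀ ≤ t₁ ∧
      (∀ t, t₀ < t → HasDerivAt v (v' t) t) ∧
      (∀ t, t₀ < t → HasDerivAt v' (v'' t) t) ∧
      ContinuousOn v'' (Set.Ioi t₀) ∧
      (∀ t, t₁ ≤ t → 0 < v t) ∧
      (∀ t, t₁ ≤ t →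
        (r' t * v' t + r t * v'' t) + h t * v' t + Qs t * v (m t) < 0) := by
  rintro ⟨v, v', v'', t₁, ht₁, hv, hv', -, hv0, hineq⟩
  have hrc : ContinuousOn r (Ioi t₀) := fun x hx => (hrd x hx).continuousAt.continuousWithinAt
  have hbc : ContinuousOn b (Ioi t₀) := fun x hx => (hbd x hx).continuousAt.continuousWithinAt
  have hpc : ContinuousOn (fun s => h s / r s) (Ioi t₀) :=
    hhc.div hrc fun x hx => (hrpos x hx).ne'
  by_cases hsign : ∀ t, t₁ + 1 ≤ t → 0 ≤ v' t
  · have hS : ∀ x, t₁ + 1 ≤ x → t₀ < x := fun x hx => by linarith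
    have hS₁ : ∀ x, t₁ + 1 ≤ x → t₁ ≤ x := fun x hx => by linarith
    have hmono : MonotoneOn v (Ici (t₁ + 1)) :=
      monotoneOn_of_hasDerivWithinAt_nonneg (convex_Ici _)
        (fun x hx => (hv x (hS x hx)).continuousAt.continuousWithinAt)
        (fun x hx => (hv x (hS x (interior_subset hx))).hasDerivWithinAt)
        (fun x hx => hsign x (interior_subset hx))
    have hc : ContinuousOn (fun s => b s * Qs s
        - (1 / 4) * r s * b s * (b' s / b s - h s / r s) ^ 2) (Ioi t₀) :=
      (hbc.mul hQc).sub (((continuousOn_const.mul hrc).mul hbc).mul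
        (((hb'c.div hbc fun x hx => (hbpos x hx).ne').sub hpc).pow 2))
    refine not_forall_frequently_lt_integral (S := t₁ + 1)
      (C := b (t₁ + 1) * (r (t₁ + 1) * v' (t₁ + 1)) / v (t₁ + 1))
      (fun t ht => intervalIntegrable_of_continuousOn_Ioi hc hT₁ (hS t ht)) (fun t ht => ?_)
      hlimsup
    exact riccati_integral_le (vm := fun x => v (m x)) ht
      (fun x hx => hbd x (hS x hx)) (fun x hx => hrd x (hS x hx))
      (fun x hx => hv x (hS x hx)) (fun x hx => hv' x (hS x hx))
      (fun x hx => hbpos x (hS x hx)) (fun x hx => hrpos x (hS x hx))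
      (fun x hx => hQpos x (hS x hx)) (fun x hx => hv0 x (hS₁ x hx)) hsign
      (fun x hx => hmono hx (le_trans hx (hmt x (hS x hx))) (hmt x (hS x hx)))
      (fun x hx => hineq x (hS₁ x hx))
      (hc.mono fun x hx => hS x hx.1).integrableOn_Icc
  · push Not at hsign
    obtain ⟨Ts, hTs, hneg⟩ := hsign
    have hTs₀ : t₀ < Ts := by linarith
    obtain ⟨T₂, hT₂, T₃, hT₃, hfreq⟩ := hcrit Ts hTs₀.le
    set E : ℝ → ℝ := fun t => Real.exp (∫ s in Ts..t, h s / r s) with hE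
    set f : ℝ → ℝ := fun t => 1 / (r t * E t) with hf
    set g : ℝ → ℝ := fun t => Qs t * E t with hg
    have hE0 : ∀ t, 0 < E t := fun t => Real.exp_pos _
    have hEd : ∀ t, t₀ < t → HasDerivAt E (E t * (h t / r t)) t := fun t ht =>
      (hasDerivAt_primitive_of_continuousOn_Ioi hTs₀ hpc ht).exp
    have hEc : ContinuousOn E (Ioi t₀) := fun x hx => (hEd x hx).continuousAt.continuousWithinAt
    have hf0 : ∀ t, t₀ < t → 0 < f t := fun t ht =>
      one_div_pos.2 (mul_pos (hrpos t ht) (hE0 t))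
    have hfc : ContinuousOn f (Ioi t₀) :=
      continuousOn_const.div (hrc.mul hEc) fun x hx => (mul_pos (hrpos x hx) (hE0 x)).ne'
    have hgc : ContinuousOn g (Ioi t₀) := hQc.mul hEc
    have hanti : AntitoneOn (fun s => ∫ σ in Ioi (m s), f σ) (Ioi t₀) := fun x hx y hy hxy =>
      antitoneOn_integral_Ioi hfc (fun z hz => (hf0 z hz).le) (lt_of_lt_of_le hx (hmt x hx))
        (lt_of_lt_of_le hy (hmt y hy)) (hmmono.monotoneOn hx hy hxy)
    have hIint : ∀ x y, t₀ < x → t₀ < y →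
        IntervalIntegrable (fun s => g s * ∫ σ in Ioi (m s), f σ) volume x y := fun x y hx hy =>
      (hanti.mono fun z hz => (lt_min hx hy).trans_le hz.1).intervalIntegrable.continuousOn_mul
        (hgc.mono fun z hz => (lt_min hx hy).trans_le hz.1)
    have hT₂₀ : t₀ < T₂ := hTs₀.trans_le hT₂
    have hT₃₀ : t₀ < T₃ := hTs₀.trans_le hT₃
    have hFc : ContinuousOn (fun τ => f τ * ∫ s in T₂..τ, g s * ∫ σ in Ioi (m s), f σ)
        (Ioi t₀) := hfc.mul (continuousOn_primitive_Ioi hT₂₀ hIint)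
    have hfreq' : ∀ M : ℝ, ∃ᶠ t in atTop,
        M < ∫ τ in T₃..t, f τ * ∫ s in T₂..τ, g s * ∫ σ in Ioi (m s), f σ := by
      have hfσ : ∀ σ, 1 / r σ * Real.exp (-∫ η in Ts..σ, h η / r η) = f σ := fun σ => by
        simp only [hf, hE, Real.exp_neg, one_div, mul_inv]
      simp_rw [hfσ, mul_right_comm] at hfreq
      exact hfreq
    have hmax : t₀ < max T₂ T₃ := hT₂₀.trans_le (le_max_left _ _)
    refine not_forall_frequently_lt_integral (S := max T₂ T₃)
      (C := v (max T₂ T₃) / -(r Ts * v' Ts * E Ts))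
      (fun t ht => intervalIntegrable_of_continuousOn_Ioi hFc hT₃₀ (hmax.trans_le ht))
      (fun t ht => ?_) hfreq'
    have hS : ∀ x, Ts ≤ x → t₀ < x := fun x hx => hTs₀.trans_le hx
    have hS₁ : ∀ x, Ts ≤ x → t₁ ≤ x := fun x hx => by linarith
    refine integral_tail_le (y := fun x => r x * v' x * E x)
      (y' := fun x => (r' x * v' x + r x * v'' x) * E x + r x * v' x * (E x * (h x / r x)))
      (hT₂.trans (le_max_left _ _)) ht (hfc.mono hS)
      (fun x hx => hf0 x (hS x hx)) (fun x hx => (mul_pos (hQpos x (hS x hx)) (hE0 x)).le)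
      (fun x hx => hmt x (hS x hx)) (fun x hx => ?_) (fun x hx => (hv0 x (hS₁ x hx)).le)
      (fun x hx => ((hrd x (hS x hx)).mul (hv' x (hS x hx))).mul (hEd x (hS x hx)))
      (fun x hx => ?_)
      (mul_neg_of_neg_of_pos (mul_neg_of_pos_of_neg (hrpos Ts hTs₀) hneg) (hE0 Ts))
      hT₂ (le_max_left _ _)
      ((intervalIntegrable_iff_integrableOn_Icc_of_le ((le_max_left _ _).trans ht)).1
        (hIint T₂ t hT₂₀ (hmax.trans_le ht)))
      (hFc.mono fun x hx => hmax.trans_le hx.1).integrableOn_Icc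
    · have h1 := (hrpos x (hS x hx)).ne'
      have h2 := (hE0 x).ne'
      convert hv x (hS x hx) using 1
      simp only [hf]
      field_simp
    · have h1 := (hrpos x (hS x hx)).ne'
      have h2 := mul_neg_of_neg_of_pos (hineq x (hS₁ x hx)) (hE0 x)
      have h3 : r x * v' x * (E x * (h x / r x)) = h x * v' x * E x := by field_simp
      rw [h3]
      linarith
end
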